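/- arXiv:1109.0658 — 5 statements merged into one kernel-verified Lean document; each statement's English description precedes it below -/
import Mathlib

section
/- Let a < b be real numbers, let α > 0, and let n = ⌊α⌋ + 1. If f : [a,b] → ℝ is of class C^n on [a,b], then its right Caputo fractional derivative of order α, x ↦ ({}_x^C D_b^α f)(x) = ((-1)^n/Γ(n-α)) ∫_x^b (t-x)^(n-α-1) f^(n)(t) dt, is continuous on the closed interval [a,b]. -/
open Set MeasureTheory intervalIntegral

/-- The right Caputo fractional derivative of order `α` (with `n = ⌊α⌋ + 1`) of a
function `f` which is `C^n` on `[a,b]`: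
`(ₓᶜD_b^α f)(x) = ((-1)^n/Γ(n-α)) ∫_x^b (t-x)^(n-α-1) f⁽ⁿ⁾(t) dt`.
(At `x = b` the interval integral is `0` by convention.) -/
noncomputable def rightCaputo (a b α : ℝ) (n : ℕ) (f : ℝ → ℝ) : ℝ → ℝ := fun x =>
  ((-1 : ℝ) ^ n / Real.Gamma ((n : ℝ) - α)) *
    ∫ t in x..b, (t - x) ^ ((n : ℝ) - α - 1) * iteratedDerivWithin n f (Set.Icc a b) t

/-- The substitution `t = x + (b - x) v` in a right Riemann–Liouville integral. -/
lemma integral_sub_rpow_mul_eq {b s x : ℝ} (hs : 0 < s) (hx : x ≤ b) (g : ℝ → ℝ) :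
    ∫ t in x..b, (t - x) ^ (s - 1) * g t =
      (b - x) ^ s * ∫ v in (0 : ℝ)..1, v ^ (s - 1) * g (x + (b - x) * v) := by
  rcases hx.eq_or_lt with rfl | hlt
  · simp [Real.zero_rpow hs.ne']
  have hc : 0 < b - x := sub_pos.2 hlt
  have hsub := intervalIntegral.smul_integral_comp_add_mul (a := 0) (b := 1)
    (fun t => (t - x) ^ (s - 1) * g t) (b - x) x
  simp only [mul_zero, add_zero, mul_one, add_sub_cancel, add_sub_cancel_left, smul_eq_mul] at hsub
  have hpow : (b - x) ^ s = (b - x) * (b - x) ^ (s - 1) := by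
    rw [Real.rpow_sub_one hc.ne']
    field_simp
  rw [← hsub, hpow, mul_assoc, ← intervalIntegral.integral_const_mul ((b - x) ^ (s - 1))]
  refine congrArg ((b - x) * ·) ?_
  refine intervalIntegral.integral_congr fun v hv => ?_
  rw [uIcc_of_le zero_le_one] at hv
  simp only [Real.mul_rpow hc.le hv.1, mul_assoc]

/-- The right Riemann–Liouville integral of a continuous function is continuous. -/
lemma continuousOn_integral_sub_rpow_mul {a b s : ℝ} (hab : a ≤ b) (hs : 0 < s) {g : ℝ → ℝ}
    (hg : ContinuousOn g (Icc a b)) :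
    ContinuousOn (fun x => ∫ t in x..b, (t - x) ^ (s - 1) * g t) (Icc a b) := by
  set G : ℝ → ℝ := IccExtend hab ((Icc a b).domRestrict g) with hG
  have hGc : Continuous G := hg.domRestrict.Icc_extend'
  have hGeq : ∀ t ∈ Icc a b, G t = g t := fun t ht => IccExtend_of_mem hab _ ht
  obtain ⟨M, hM⟩ := isCompact_Icc.exists_bound_of_continuousOn hg
  have hGM : ∀ t, ‖G t‖ ≤ M := fun t => hM _ (projIcc a b hab t).2
  have hcont : Continuous fun x : ℝ =>
      (b - x) ^ s * ∫ v in (0 : ℝ)..1, v ^ (s - 1) * G (x + (b - x) * v) := by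
    refine ((Real.continuous_rpow_const hs.le).comp (by fun_prop : Continuous fun x => b - x)).mul ?_
    refine intervalIntegral.continuous_of_dominated_interval
      (bound := fun v => v ^ (s - 1) * M) (fun x => ?_) (fun x => ?_) ?_ ?_
    · have : Measurable fun v : ℝ => G (x + (b - x) * v) :=
        (hGc.comp (by fun_prop)).measurable
      exact ((measurable_id.pow_const (s - 1)).mul this).aestronglyMeasurable
    · refine Filter.Eventually.of_forall fun v hv => ?_
      rw [uIoc_of_le zero_le_one] at hv
      have hv0 : 0 ≤ v ^ (s - 1) := Real.rpow_nonneg hv.1.le _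
      rw [norm_mul, Real.norm_of_nonneg hv0]
      exact mul_le_mul_of_nonneg_left (hGM _) hv0
    · exact (intervalIntegral.intervalIntegrable_rpow' (by linarith)).mul_const M
    · exact Filter.Eventually.of_forall fun v _ =>
        continuous_const.mul (hGc.comp (by fun_prop))
  refine hcont.continuousOn.congr fun x hx => ?_
  simp only
  rw [← integral_sub_rpow_mul_eq hs hx.2 G]
  refine intervalIntegral.integral_congr fun t ht => ?_
  rw [uIcc_of_le hx.2] at ht
  simp only [hGeq t ⟨hx.1.trans ht.1, ht.2⟩]

/-- If `f` is of class `C^n` on `[a,b]` (where `n = ⌊α⌋ + 1`, `α > 0`), then its right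
Caputo fractional derivative of order `α` is continuous on the closed interval `[a,b]`. -/
theorem rightCaputo_continuousOn (a b α : ℝ) (ha : a < b) (hα : 0 < α)
    (n : ℕ) (hn : n = ⌊α⌋.toNat + 1)
    (f : ℝ → ℝ) (hf : ContDiffOn ℝ n f (Set.Icc a b)) :
    ContinuousOn (rightCaputo a b α n f) (Set.Icc a b) := by
  have hs : 0 < (n : ℝ) - α := by
    have hfloor : ((⌊α⌋.toNat : ℤ) : ℝ) = ⌊α⌋ := by
      rw [Int.toNat_of_nonneg (Int.floor_nonneg.2 hα.le)]
    rw [hn, Nat.cast_add, Nat.cast_one, ← Int.cast_natCast, hfloor]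
    linarith [Int.lt_floor_add_one α]
  exact continuousOn_const.mul (continuousOn_integral_sub_rpow_mul ha.le hs
    (hf.continuousOn_iteratedDerivWithin le_rfl (uniqueDiffOn_Icc ha)))
end

section
/- Let a < b be real numbers and 0 < α < 1. For all f, g : [a,b] → ℝ of class C^1 on [a,b] such that the right Riemann–Liouville fractional derivative ({}_x D_b^α g)(x) exists for all x ∈ [a,b] and the integrands below are integrable, ∫_a^b g(x)·({}_a^C D_x^α f)(x) dx = ∫_a^b f(x)·({}_x D_b^α g)(x) dx + [ ({}_x I_b^{1-α} g)(x) · f(x) ]_a^b, where [h(x)]_a^b := h(b) − h(a). -/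
open Set MeasureTheory intervalIntegral

/-- Left Caputo fractional derivative of order `α ∈ (0,1)` of `f`, `C^1` on `[a,b]`:
`(ₐᶜDₓ^α f)(x) = (1/Γ(1-α)) ∫_a^x (x-t)^(-α) f'(t) dt`. -/
noncomputable def leftCaputo (a b α : ℝ) (f : ℝ → ℝ) : ℝ → ℝ := fun x =>
  (1 / Real.Gamma (1 - α)) *
    ∫ t in a..x, (x - t) ^ (-α) * derivWithin f (Set.Icc a b) t

/-- Right Riemann–Liouville fractional integral of order `1-α`:
`(ₓI_b^{1-α} g)(x) = (1/Γ(1-α)) ∫_x^b (t-x)^(-α) g(t) dt`. -/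
noncomputable def rlIntRight (b α : ℝ) (g : ℝ → ℝ) : ℝ → ℝ := fun x =>
  (1 / Real.Gamma (1 - α)) * ∫ t in x..b, (t - x) ^ (-α) * g t

/-- Right Riemann–Liouville fractional derivative of order `α ∈ (0,1)`:
`(ₓD_b^α g)(x) = -(d/dx)[(ₓI_b^{1-α} g)(x)]`. -/
noncomputable def rlDerRight (b α : ℝ) (g : ℝ → ℝ) : ℝ → ℝ := fun x =>
  -deriv (rlIntRight b α g) x

/-- Fubini on the triangle `a < t < x ≤ b` for the Abel kernel `(x - t) ^ (-α)`. -/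
theorem integral_mul_integral_abel_kernel_swap {a b α : ℝ} (hab : a ≤ b) (hα : α < 1)
    {u g : ℝ → ℝ} (hu : ContinuousOn u (Set.Icc a b)) (hg : ContinuousOn g (Set.Icc a b)) :
    ∫ x in a..b, g x * ∫ t in a..x, (x - t) ^ (-α) * u t
      = ∫ t in a..b, u t * ∫ x in t..b, (x - t) ^ (-α) * g x := by
  set h : ℝ → ℝ := (Set.Ioc 0 (b - a)).indicator fun s => s ^ (-α) with hh
  set F : ℝ → ℝ := (Set.Ioc a b).indicator u with hF
  set G : ℝ → ℝ := (Set.Ioc a b).indicator g with hG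
  have h_int : Integrable h := by
    rw [hh, integrable_indicator_iff measurableSet_Ioc,
      ← intervalIntegrable_iff_integrableOn_Ioc_of_le (by linarith)]
    exact intervalIntegrable_rpow' (by linarith)
  have F_int : Integrable F := by
    rw [hF, integrable_indicator_iff measurableSet_Ioc]
    exact hu.integrableOn_Icc.mono_set Ioc_subset_Icc_self
  have G_int : Integrable G := by
    rw [hG, integrable_indicator_iff measurableSet_Ioc]
    exact hg.integrableOn_Icc.mono_set Ioc_subset_Icc_self
  obtain ⟨C, hC⟩ := isCompact_Icc.exists_bound_of_continuousOn hg
  have G_bound : ∀ x, ‖G x‖ ≤ max C 0 := fun x => by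
    by_cases hx : x ∈ Set.Ioc a b
    · simpa only [hG, indicator_of_mem hx] using
        (hC x (Ioc_subset_Icc_self hx)).trans (le_max_left _ _)
    · simp [hG, indicator_of_notMem hx]
  have prod_int : Integrable (fun p : ℝ × ℝ => G p.1 * (F p.2 * h (p.1 - p.2)))
      (volume.prod volume) :=
    (F_int.convolution_integrand (ContinuousLinearMap.mul ℝ ℝ) h_int).bdd_mul
      G_int.aestronglyMeasurable.comp_fst (Filter.Eventually.of_forall fun p => G_bound p.1)
  have swap := integral_integral_swap (f := fun x t => G x * (F t * h (x - t))) prod_int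
  have left : ∀ x, ∫ t, G x * (F t * h (x - t))
      = (Set.Ioc a b).indicator (fun x => g x * ∫ t in a..x, (x - t) ^ (-α) * u t) x := by
    intro x
    rw [MeasureTheory.integral_const_mul]
    by_cases hx : x ∈ Set.Ioc a b
    · rw [indicator_of_mem hx, hG, indicator_of_mem hx, integral_of_le hx.1.le,
        integral_Ioc_eq_integral_Ioo, ← MeasureTheory.integral_indicator measurableSet_Ioo]
      congr 2
      ext t
      obtain ⟨hx₁, hx₂⟩ := hx
      by_cases ht : t ∈ Set.Ioo a x
      · rw [indicator_of_mem ht, hF, hh,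
          indicator_of_mem (show t ∈ Set.Ioc a b from ⟨ht.1, by linarith [ht.2]⟩),
          indicator_of_mem (show x - t ∈ Set.Ioc 0 (b - a) from
            ⟨by linarith [ht.2], by linarith [ht.1]⟩), mul_comm]
      · rw [indicator_of_notMem ht]
        by_cases hat : a < t
        · have : x - t ∉ Set.Ioc 0 (b - a) := fun hm => ht ⟨hat, by linarith [hm.1]⟩
          rw [hh, indicator_of_notMem this, mul_zero]
        · rw [hF, indicator_of_notMem fun hm => hat hm.1, zero_mul]
    · rw [indicator_of_notMem hx, hG, indicator_of_notMem hx, zero_mul]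
  have right : ∀ t, ∫ x, G x * (F t * h (x - t))
      = (Set.Ioc a b).indicator (fun t => u t * ∫ x in t..b, (x - t) ^ (-α) * g x) t := by
    intro t
    simp_rw [mul_left_comm _ (F t)]
    rw [MeasureTheory.integral_const_mul]
    by_cases ht : t ∈ Set.Ioc a b
    · rw [indicator_of_mem ht, hF, indicator_of_mem ht, integral_of_le ht.2,
        ← MeasureTheory.integral_indicator measurableSet_Ioc]
      congr 2
      ext x
      obtain ⟨ht₁, ht₂⟩ := ht
      by_cases hx : x ∈ Set.Ioc t b
      · rw [indicator_of_mem hx, hG, hh,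
          indicator_of_mem (show x ∈ Set.Ioc a b from ⟨by linarith [hx.1], hx.2⟩),
          indicator_of_mem (show x - t ∈ Set.Ioc 0 (b - a) from
            ⟨by linarith [hx.1], by linarith [hx.2]⟩), mul_comm]
      · rw [indicator_of_notMem hx]
        by_cases hxb : x ≤ b
        · have : x - t ∉ Set.Ioc 0 (b - a) := fun hm => hx ⟨by linarith [hm.1], hxb⟩
          rw [hh, indicator_of_notMem this, mul_zero]
        · rw [hG, indicator_of_notMem fun hm => hxb hm.2, zero_mul]
    · rw [indicator_of_notMem ht, hF, indicator_of_notMem ht, zero_mul]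
  simp_rw [left, right] at swap
  rwa [MeasureTheory.integral_indicator measurableSet_Ioc,
    MeasureTheory.integral_indicator measurableSet_Ioc, ← integral_of_le hab, ← integral_of_le hab] at swap

/-- Integration by parts formula, case `0 < α < 1`:
`∫_a^b g·(ₐᶜDₓ^α f) = ∫_a^b f·(ₓD_b^α g) + [(ₓI_b^{1-α} g)·f]_a^b`. -/
theorem caputo_integration_by_parts_left_frac_order (a b α : ℝ) (ha : a < b)
    (hα₀ : 0 < α) (hα₁ : α < 1) (f g : ℝ → ℝ)
    (hf : ContDiffOn ℝ 1 f (Set.Icc a b)) (hg : ContDiffOn ℝ 1 g (Set.Icc a b))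
    -- the right Riemann–Liouville derivative of `g` exists on `[a,b]`:
    (hex : ∀ x ∈ Set.Icc a b, DifferentiableAt ℝ (rlIntRight b α g) x)
    -- integrability of the integrands:
    (hi₁ : IntervalIntegrable (fun x => g x * leftCaputo a b α f x) volume a b)
    (hi₂ : IntervalIntegrable (fun x => f x * rlDerRight b α g x) volume a b) :
    ∫ x in a..b, g x * leftCaputo a b α f x
      = (∫ x in a..b, f x * rlDerRight b α g x)
        + (rlIntRight b α g b * f b - rlIntRight b α g a * f a) := by
  set f' := derivWithin f (Set.Icc a b) with hf'
  have f'_cont : ContinuousOn f' (Set.Icc a b) :=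
    hf.continuousOn_derivWithin (uniqueDiffOn_Icc ha) le_rfl
  have I_cont : ContinuousOn (rlIntRight b α g) (Set.Icc a b) :=
    fun x hx => (hex x hx).continuousAt.continuousWithinAt
  have fubini : ∫ x in a..b, g x * leftCaputo a b α f x
      = ∫ x in a..b, f' x * rlIntRight b α g x := by
    simp only [leftCaputo, rlIntRight, mul_left_comm _ (1 / Real.Gamma (1 - α)),
      intervalIntegral.integral_const_mul]
    rw [integral_mul_integral_abel_kernel_swap ha.le hα₁ f'_cont hg.continuousOn]
  have f'I_int : IntervalIntegrable (fun x => f' x * rlIntRight b α g x) volume a b :=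
    (f'_cont.mul I_cont).intervalIntegrable_of_Icc ha.le
  have ftc := integral_eq_sub_of_hasDerivAt_of_le ha.le (hf.continuousOn.mul I_cont)
    (f' := fun x => f' x * rlIntRight b α g x - f x * rlDerRight b α g x)
    (fun x hx => by
      have hfx : HasDerivAt f (f' x) x :=
        ((hf.differentiableOn one_ne_zero x (Ioo_subset_Icc_self hx)).hasDerivWithinAt).hasDerivAt
          (Icc_mem_nhds hx.1 hx.2)
      simpa [rlDerRight] using hfx.mul (hex x (Ioo_subset_Icc_self hx)).hasDerivAt)
    (f'I_int.sub hi₂)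
  rw [intervalIntegral.integral_sub f'I_int hi₂] at ftc
  simp only [Pi.mul_apply] at ftc
  rw [fubini]
  linarith
end

section
/- Let a < b be real numbers and 0 < α < 1. For all f, g : [a,b] → ℝ of class C^1 on [a,b] such that f(a) = f(b) = 0, the right Riemann–Liouville fractional derivative ({}_x D_b^α g)(x) exists for all x ∈ [a,b], and the integrands below are integrable, one has ∫_a^b g(x)·({}_a^C D_x^α f)(x) dx = ∫_a^b f(x)·({}_x D_b^α g)(x) dx. -/
open Set MeasureTheory intervalIntegral

/-- Exchange of the order of integration over a triangle for a weakly singular kernel. -/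
theorem integral_mul_integral_rpow_swap {a b α : ℝ} (hab : a ≤ b) (hα₀ : 0 < α) (hα₁ : α < 1)
    {u v : ℝ → ℝ} (hu : ContinuousOn u (Icc a b)) (hv : ContinuousOn v (Icc a b)) :
    ∫ x in a..b, v x * ∫ t in a..x, (x - t) ^ (-α) * u t
      = ∫ x in a..b, u x * ∫ t in x..b, (t - x) ^ (-α) * v t := by
  set k : ℝ → ℝ := (Ioc 0 (b - a)).indicator fun s => s ^ (-α) with hk
  set U : ℝ → ℝ := (Ioc a b).indicator u with hU
  set V : ℝ → ℝ := (Ioc a b).indicator v with hV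
  have hki : Integrable k := by
    rw [hk, integrable_indicator_iff measurableSet_Ioc,
      ← intervalIntegrable_iff_integrableOn_Ioc_of_le (by linarith)]
    exact intervalIntegrable_rpow' (by linarith)
  have hUi : Integrable U := by
    rw [hU, integrable_indicator_iff measurableSet_Ioc]
    exact hu.integrableOn_Icc.mono_set Ioc_subset_Icc_self
  have hVi : Integrable V := by
    rw [hV, integrable_indicator_iff measurableSet_Ioc]
    exact hv.integrableOn_Icc.mono_set Ioc_subset_Icc_self
  obtain ⟨C, hC⟩ := isCompact_Icc.exists_bound_of_continuousOn hv
  have hVb : ∀ x, ‖V x‖ ≤ max C 0 := by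
    intro x
    by_cases hx : x ∈ Ioc a b
    · rw [hV, indicator_of_mem hx]
      exact (hC x (Ioc_subset_Icc_self hx)).trans (le_max_left _ _)
    · rw [hV, indicator_of_notMem hx, norm_zero]
      exact le_max_right _ _
  have hint : Integrable (Function.uncurry fun x t => V x * (U t * k (x - t)))
      (volume.prod volume) := by
    have h := hUi.convolution_integrand (ContinuousLinearMap.mul ℝ ℝ) hki
    exact h.bdd_mul (c := max C 0) (hVi.aestronglyMeasurable.comp_fst)
      (Filter.Eventually.of_forall fun p => hVb p.1)
  have hswap := integral_integral_swap hint
  have hleft : ∫ x in a..b, v x * ∫ t in a..x, (x - t) ^ (-α) * u t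
      = ∫ x, ∫ t, V x * (U t * k (x - t)) := by
    rw [integral_of_le hab, ← MeasureTheory.integral_indicator measurableSet_Ioc]
    congr 1 with x
    rw [MeasureTheory.integral_const_mul]
    by_cases hx : x ∈ Ioc a b
    · rw [indicator_of_mem hx, hV, indicator_of_mem hx, integral_of_le hx.1.le,
        ← MeasureTheory.integral_indicator measurableSet_Ioc]
      congr 2 with t
      simp only [hU, hk, indicator_apply, mem_Ioc] at hx ⊢
      rcases eq_or_ne t x with rfl | hne
      · simp [Real.zero_rpow (neg_ne_zero.2 hα₀.ne')]
      · rcases lt_or_gt_of_ne hne with h | h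
        · by_cases h' : a < t
          · rw [if_pos ⟨h', h.le⟩, if_pos ⟨h', by linarith⟩,
              if_pos ⟨by linarith, by linarith⟩, mul_comm]
          · simp [h']
        · simp [h.not_ge, h.not_gt]
    · simp [hV, hx]
  have hright : ∫ x in a..b, u x * ∫ t in x..b, (t - x) ^ (-α) * v t
      = ∫ t, ∫ x, V x * (U t * k (x - t)) := by
    rw [integral_of_le hab, ← MeasureTheory.integral_indicator measurableSet_Ioc]
    congr 1 with x
    simp only [mul_left_comm (V _) (U _)]
    rw [MeasureTheory.integral_const_mul]
    by_cases hx : x ∈ Ioc a b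
    · rw [indicator_of_mem hx, hU, indicator_of_mem hx, integral_of_le hx.2,
        ← MeasureTheory.integral_indicator measurableSet_Ioc]
      congr 2 with t
      simp only [hV, hk, indicator_apply, mem_Ioc] at hx ⊢
      by_cases h : x < t
      · by_cases h' : t ≤ b
        · rw [if_pos ⟨h, h'⟩, if_pos ⟨by linarith, h'⟩,
            if_pos ⟨by linarith, by linarith⟩, mul_comm]
        · simp [h']
      · simp [h]
    · simp [hU, hx]
  rw [hleft, hright, hswap]

/-- Integration by parts without boundary terms, case `0 < α < 1`, `f(a) = f(b) = 0`:
`∫_a^b g·(ₐᶜDₓ^α f) = ∫_a^b f·(ₓD_b^α g)`. -/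
theorem caputo_integration_by_parts_left_zero_boundary (a b α : ℝ) (ha : a < b)
    (hα₀ : 0 < α) (hα₁ : α < 1) (f g : ℝ → ℝ)
    (hf : ContDiffOn ℝ 1 f (Set.Icc a b)) (hg : ContDiffOn ℝ 1 g (Set.Icc a b))
    (hfa : f a = 0) (hfb : f b = 0)
    -- the right Riemann–Liouville derivative of `g` exists on `[a,b]`:
    (hex : ∀ x ∈ Set.Icc a b, DifferentiableAt ℝ (rlIntRight b α g) x)
    -- integrability of the integrands:
    (hi₁ : IntervalIntegrable (fun x => g x * leftCaputo a b α f x) volume a b)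
    (hi₂ : IntervalIntegrable (fun x => f x * rlDerRight b α g x) volume a b) :
    ∫ x in a..b, g x * leftCaputo a b α f x
      = ∫ x in a..b, f x * rlDerRight b α g x := by
  set f' : ℝ → ℝ := derivWithin f (Icc a b) with hf'
  set G : ℝ → ℝ := rlIntRight b α g with hG
  have hf'c : ContinuousOn f' (Icc a b) :=
    hf.continuousOn_derivWithin (uniqueDiffOn_Icc ha) le_rfl
  have hGc : ContinuousOn G (Icc a b) := fun x hx => (hex x hx).continuousAt.continuousWithinAt
  have hfG : IntervalIntegrable (fun x => f' x * G x) volume a b :=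
    (hf'c.mul hGc).intervalIntegrable_of_Icc ha.le
  have hparts : ∫ x in a..b, (f' x * G x - f x * rlDerRight b α g x) = 0 := by
    rw [integral_eq_sub_of_hasDerivAt_of_le (f := fun x => f x * G x) ha.le
      (hf.continuousOn.mul hGc) ?_ (hfG.sub hi₂)]
    · simp [hfa, hfb]
    · intro x hx
      have hfx : HasDerivAt f (f' x) x :=
        ((hf.differentiableOn one_ne_zero x (Ioo_subset_Icc_self hx)).hasDerivWithinAt).hasDerivAt
          (Icc_mem_nhds hx.1 hx.2)
      refine (hfx.mul (hex x (Ioo_subset_Icc_self hx)).hasDerivAt).congr_deriv ?_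
      simp only [rlDerRight]
      ring
  rw [integral_sub hfG hi₂, sub_eq_zero] at hparts
  rw [← hparts]
  simp only [hG, leftCaputo, rlIntRight, mul_left_comm _ (1 / Real.Gamma (1 - α))]
  rw [intervalIntegral.integral_const_mul, intervalIntegral.integral_const_mul,
    integral_mul_integral_rpow_swap ha.le hα₀ hα₁ hf'c hg.continuousOn]
end

section
/- (Fractional Euler–Lagrange equation.) Let a < b, α, β ∈ (0,1), y_a, y_b ∈ ℝ, and let L : [a,b] × ℝ × ℝ × ℝ → ℝ be of class C^1. Let E := { y ∈ C^1([a,b]) : y(a) = y_a and y(b) = y_b }. For y ∈ E write ({}^C_α[y]_β)(x) := (x, y(x), ({}_a^C D_x^α y)(x), ({}_x^C D_b^β y)(x)) and J(y) := ∫_a^b L(({}^C_α[y]_β)(x)) dx. Assume that for every y ∈ E the function x ↦ ∂₃L(({}^C_α[y]_β)(x)) has a continuous right Riemann–Liouville fractional derivative of order α on [a,b] and the function x ↦ ∂₄L(({}^C_α[y]_β)(x)) has a continuous left Riemann–Liouville fractional derivative of order β on [a,b]. If y ∈ E is a minimizer or a maximizer of J on E, then for all x ∈ [a,b]: ∂₂L(({}^C_α[y]_β)(x))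 + {}_x D_b^α[ t ↦ ∂₃L(({}^C_α[y]_β)(t)) ](x) + {}_a D_x^β[ t ↦ ∂₄L(({}^C_α[y]_β)(t)) ](x) = 0. -/
open Set MeasureTheory intervalIntegral

/-- Left Caputo fractional derivative of order `γ ∈ (0,1)` of `f`, `C^1` on `[a,b]`:
`(ₐᶜDₓ^γ f)(x) = (1/Γ(1-γ)) ∫_a^x (x-t)^(-γ) f'(t) dt`. -/
noncomputable def capL (a b γ : ℝ) (f : ℝ → ℝ) : ℝ → ℝ := fun x =>
  (1 / Real.Gamma (1 - γ)) *
    ∫ t in a..x, (x - t) ^ (-γ) * derivWithin f (Set.Icc a b) t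

/-- Right Caputo fractional derivative of order `γ ∈ (0,1)` of `f`, `C^1` on `[a,b]`:
`(ₓᶜD_b^γ f)(x) = -(1/Γ(1-γ)) ∫_x^b (t-x)^(-γ) f'(t) dt`. -/
noncomputable def capR (a b γ : ℝ) (f : ℝ → ℝ) : ℝ → ℝ := fun x =>
  -((1 / Real.Gamma (1 - γ)) *
    ∫ t in x..b, (t - x) ^ (-γ) * derivWithin f (Set.Icc a b) t)

/-- Left Riemann–Liouville fractional integral of order `1-γ`. -/
noncomputable def rlIl (a γ : ℝ) (h : ℝ → ℝ) : ℝ → ℝ := fun x =>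
  (1 / Real.Gamma (1 - γ)) * ∫ t in a..x, (x - t) ^ (-γ) * h t

/-- Right Riemann–Liouville fractional integral of order `1-γ`. -/
noncomputable def rlIr (b γ : ℝ) (h : ℝ → ℝ) : ℝ → ℝ := fun x =>
  (1 / Real.Gamma (1 - γ)) * ∫ t in x..b, (t - x) ^ (-γ) * h t

/-- Left Riemann–Liouville fractional derivative of order `γ ∈ (0,1)`:
`(ₐDₓ^γ h)(x) = (d/dx)[(ₐIₓ^{1-γ} h)(x)]`. -/
noncomputable def rlDl (a γ : ℝ) (h : ℝ → ℝ) : ℝ → ℝ := fun x => deriv (rlIl a γ h) x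

/-- Right Riemann–Liouville fractional derivative of order `γ ∈ (0,1)`:
`(ₓD_b^γ h)(x) = -(d/dx)[(ₓI_b^{1-γ} h)(x)]`. -/
noncomputable def rlDr (b γ : ℝ) (h : ℝ → ℝ) : ℝ → ℝ := fun x => -deriv (rlIr b γ h) x

/-- Membership in `E = { y ∈ C¹([a,b]) : y(a) = y_a, y(b) = y_b }`. -/
def inE (a b ya yb : ℝ) (y : ℝ → ℝ) : Prop :=
  ContDiffOn ℝ 1 y (Set.Icc a b) ∧ y a = ya ∧ y b = yb

/-- `∂₂L` along `(ᶜ_α[y]_β)(x) = (x, y(x), (ₐᶜDₓ^α y)(x), (ₓᶜD_b^β y)(x))`. -/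
noncomputable def P2 (a b α β : ℝ) (L : ℝ → ℝ → ℝ → ℝ → ℝ) (y : ℝ → ℝ) (x : ℝ) : ℝ :=
  deriv (fun u => L x u (capL a b α y x) (capR a b β y x)) (y x)

/-- `∂₃L` along `(ᶜ_α[y]_β)(x)`. -/
noncomputable def P3 (a b α β : ℝ) (L : ℝ → ℝ → ℝ → ℝ → ℝ) (y : ℝ → ℝ) (x : ℝ) : ℝ :=
  deriv (fun u => L x (y x) u (capR a b β y x)) (capL a b α y x)

/-- `∂₄L` along `(ᶜ_α[y]_β)(x)`. -/
noncomputable def P4 (a b α β : ℝ) (L : ℝ → ℝ → ℝ → ℝ → ℝ) (y : ℝ → ℝ) (x : ℝ) : ℝ :=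
  deriv (fun u => L x (y x) (capL a b α y x) u) (capR a b β y x)

/-- The functional `J(y) = ∫_a^b L((ᶜ_α[y]_β)(x)) dx`. -/
noncomputable def Jfun (a b α β : ℝ) (L : ℝ → ℝ → ℝ → ℝ → ℝ) (y : ℝ → ℝ) : ℝ :=
  ∫ x in a..b, L x (y x) (capL a b α y x) (capR a b β y x)

lemma exists_continuous_bounded_eqOn_Icc {a b : ℝ} (hab : a ≤ b) {g : ℝ → ℝ}
    (hg : ContinuousOn g (Icc a b)) :
    ∃ G : ℝ → ℝ, Continuous G ∧ (∃ M, ∀ x, ‖G x‖ ≤ M) ∧ EqOn g G (Icc a b) := by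
  obtain ⟨M, hM⟩ := isCompact_Icc.exists_bound_of_continuousOn hg
  refine ⟨IccExtend hab ((Icc a b).domRestrict g),
    (continuousOn_iff_continuous_domRestrict.mp hg).Icc_extend', ⟨M, fun x => ?_⟩, fun x hx => ?_⟩
  · exact hM _ (projIcc a b hab x).2
  · rw [IccExtend_of_mem hab _ hx]
    rfl

lemma rlIl_congr {a b γ x : ℝ} {g h : ℝ → ℝ} (hgh : EqOn g h (Icc a b)) (hx : x ∈ Icc a b) :
    rlIl a γ g x = rlIl a γ h x := by
  unfold rlIl
  congr 1
  refine integral_congr fun t ht => ?_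
  rw [uIcc_of_le hx.1] at ht
  simp only [hgh ⟨ht.1, ht.2.trans hx.2⟩]

lemma rlIr_congr {a b γ x : ℝ} {g h : ℝ → ℝ} (hgh : EqOn g h (Icc a b)) (hx : x ∈ Icc a b) :
    rlIr b γ g x = rlIr b γ h x := by
  unfold rlIr
  congr 1
  refine integral_congr fun t ht => ?_
  rw [uIcc_of_le hx.2] at ht
  simp only [hgh ⟨hx.1.trans ht.1, ht.2⟩]

lemma rlIr_eq_rlIl_reflect (a b γ : ℝ) (g : ℝ → ℝ) (x : ℝ) :
    rlIr b γ g x = rlIl a γ (fun t => g (a + b - t)) (a + b - x) := by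
  unfold rlIr rlIl
  congr 1
  have h := intervalIntegral.integral_comp_sub_left (a := a) (b := a + b - x)
    (fun t => (t - x) ^ (-γ) * g t) (a + b)
  rw [show a + b - (a + b - x) = x by ring, show a + b - a = b by ring] at h
  rw [← h]
  refine integral_congr fun t _ => ?_
  simp only [show a + b - t - x = a + b - x - t by ring]

lemma intervalIntegrable_sub_rpow {γ : ℝ} (hγ : γ < 1) (a b x : ℝ) :
    IntervalIntegrable (fun t => (x - t) ^ (-γ)) volume a b := by
  have h := (intervalIntegrable_rpow' (a := x - a) (b := x - b)
    (r := -γ) (by linarith)).comp_sub_left x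
  simpa using h

lemma continuousOn_rlIl {a b γ : ℝ} (hab : a ≤ b) (hγ : γ < 1) {g : ℝ → ℝ}
    (hg : ContinuousOn g (Icc a b)) : ContinuousOn (rlIl a γ g) (Icc a b) := by
  obtain ⟨G, hGc, ⟨M, hM⟩, hgG⟩ := exists_continuous_bounded_eqOn_Icc hab hg
  have hint : Continuous fun x : ℝ =>
      ∫ u in (0 : ℝ)..1, (1 - u) ^ (-γ) * G (a + (x - a) * u) := by
    refine continuous_of_dominated_interval (bound := fun u => ‖(1 - u) ^ (-γ)‖ * M) ?_ ?_ ?_ ?_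
    · intro x
      exact (by fun_prop : Measurable fun u : ℝ =>
        (1 - u) ^ (-γ) * G (a + (x - a) * u)).aestronglyMeasurable
    · intro x
      refine ae_of_all _ fun t _ => ?_
      rw [norm_mul]
      gcongr
      exact hM _
    · exact (intervalIntegrable_sub_rpow hγ 0 1 1).norm.mul_const M
    · exact ae_of_all _ fun t _ => by fun_prop
  have hpow : Continuous fun x : ℝ => (x - a) ^ (1 + -γ) :=
    (continuous_id.sub continuous_const).rpow_const fun x => Or.inr (by linarith)
  refine ((hpow.mul hint).const_mul (1 / Real.Gamma (1 - γ))).continuousOn.congr fun x hx => ?_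
  rw [rlIl_congr hgG hx]
  unfold rlIl
  have hxa : 0 ≤ x - a := sub_nonneg.mpr hx.1
  have h := intervalIntegral.smul_integral_comp_add_mul (a := 0) (b := 1)
    (fun t => (x - t) ^ (-γ) * G t) (x - a) a
  simp only [mul_zero, add_zero, mul_one, add_sub_cancel, smul_eq_mul] at h
  simp only [Pi.mul_apply]
  rw [← h, Real.rpow_one_add' hxa (by linarith), mul_assoc (x - a),
    ← intervalIntegral.integral_const_mul ((x - a) ^ (-γ))]
  congr 2
  refine integral_congr fun u hu => ?_
  rw [uIcc_of_le (zero_le_one' ℝ)] at hu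
  rw [show x - (a + (x - a) * u) = (x - a) * (1 - u) by ring,
    Real.mul_rpow hxa (by linarith [hu.2]), mul_assoc]

lemma continuousOn_rlIr {a b γ : ℝ} (hab : a ≤ b) (hγ : γ < 1) {g : ℝ → ℝ}
    (hg : ContinuousOn g (Icc a b)) : ContinuousOn (rlIr b γ g) (Icc a b) := by
  have hmaps : MapsTo (fun x => a + b - x) (Icc a b) (Icc a b) := fun x hx =>
    ⟨by linarith [hx.2], by linarith [hx.1]⟩
  have hrefl : ContinuousOn (fun x => a + b - x) (Icc a b) := by fun_prop
  rw [show rlIr b γ g = fun x => rlIl a γ (fun t => g (a + b - t)) (a + b - x) from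
    funext fun x => rlIr_eq_rlIl_reflect a b γ g x]
  exact (continuousOn_rlIl hab hγ (hg.comp hrefl hmaps)).comp hrefl hmaps

lemma rlIl_add_const_mul {a b γ x : ℝ} (hγ : γ < 1) {f g : ℝ → ℝ}
    (hf : ContinuousOn f (Icc a b)) (hg : ContinuousOn g (Icc a b)) (hx : x ∈ Icc a b) (c : ℝ) :
    rlIl a γ (fun t => f t + c * g t) x = rlIl a γ f x + c * rlIl a γ g x := by
  have hsub : uIcc a x ⊆ Icc a b := by
    rw [uIcc_of_le hx.1]
    exact Icc_subset_Icc_right hx.2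
  have hk := intervalIntegrable_sub_rpow hγ a x x
  unfold rlIl
  rw [show (fun t => (x - t) ^ (-γ) * (f t + c * g t)) =
      fun t => (x - t) ^ (-γ) * f t + c * ((x - t) ^ (-γ) * g t) by ext t; ring,
    intervalIntegral.integral_add (hk.mul_continuousOn (hf.mono hsub))
      ((hk.mul_continuousOn (hg.mono hsub)).const_mul c),
    intervalIntegral.integral_const_mul]
  ring

lemma rlIr_add_const_mul {a b γ x : ℝ} (hγ : γ < 1) {f g : ℝ → ℝ}
    (hf : ContinuousOn f (Icc a b)) (hg : ContinuousOn g (Icc a b)) (hx : x ∈ Icc a b) (c : ℝ) :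
    rlIr b γ (fun t => f t + c * g t) x = rlIr b γ f x + c * rlIr b γ g x := by
  have hmaps : MapsTo (fun x => a + b - x) (Icc a b) (Icc a b) := fun x hx =>
    ⟨by linarith [hx.2], by linarith [hx.1]⟩
  have hrefl : ContinuousOn (fun x => a + b - x) (Icc a b) := by fun_prop
  simp only [rlIr_eq_rlIl_reflect a b γ]
  exact rlIl_add_const_mul hγ (hf.comp hrefl hmaps) (hg.comp hrefl hmaps) (hmaps hx) c

/-- Fubini's theorem for fractional integrals: `rlIl a γ` and `rlIr b γ` are adjoint. -/
lemma integral_mul_rlIl {a b γ : ℝ} (hab : a ≤ b) (hγ0 : γ ≠ 0) (hγ : γ < 1) {g h : ℝ → ℝ}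
    (hg : ContinuousOn g (Icc a b)) (hh : ContinuousOn h (Icc a b)) :
    ∫ x in a..b, h x * rlIl a γ g x = ∫ t in a..b, g t * rlIr b γ h t := by
  let K : ℝ → ℝ := (Ioc 0 (b - a)).indicator fun s => s ^ (-γ)
  have hK : Integrable K volume := by
    rw [integrable_indicator_iff measurableSet_Ioc]
    exact (intervalIntegrable_iff_integrableOn_Ioc_of_le (sub_nonneg.mpr hab)).mp
      (intervalIntegrable_rpow' (by linarith))
  obtain ⟨H, hHc, ⟨M, hM⟩, hhH⟩ := exists_continuous_bounded_eqOn_Icc hab hh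
  have hgI : Integrable g (volume.restrict (Ioc a b)) :=
    (hg.integrableOn_Icc (μ := volume)).mono_set Ioc_subset_Icc_self
  have hconv : Integrable (Function.uncurry fun x t => H x * (g t * K (x - t)))
      ((volume.restrict (Ioc a b)).prod (volume.restrict (Ioc a b))) := by
    have h1 := hgI.convolution_integrand (ContinuousLinearMap.mul ℝ ℝ) hK
    have h2 := h1.mono_measure
      (Measure.prod_mono (Measure.restrict_le_self (μ := volume) (s := Ioc a b)) le_rfl)
    exact h2.bdd_mul (c := M) (hHc.comp continuous_fst).aestronglyMeasurable
      (ae_of_all _ fun p => hM p.1)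
  have hswap := integral_integral_swap hconv
  have hleft : ∀ x ∈ Ioc a b, ∫ t in Ioc a b, H x * (g t * K (x - t)) =
      h x * ∫ t in a..x, (x - t) ^ (-γ) * g t := by
    intro x hx
    rw [MeasureTheory.integral_const_mul, hhH ⟨hx.1.le, hx.2⟩, integral_of_le hx.1.le,
      setIntegral_eq_of_subset_of_forall_sdiff_eq_zero measurableSet_Ioc
        (Ioc_subset_Ioc_right hx.2)]
    · congr 1
      refine setIntegral_congr_fun measurableSet_Ioc fun t ht => ?_
      rcases ht.2.lt_or_eq with h' | h'
      · simp only [K]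
        rw [indicator_of_mem (by constructor <;> linarith [ht.1, hx.2]), mul_comm]
      · simp [K, h', Real.zero_rpow (neg_ne_zero.mpr hγ0)]
    · intro t ht
      have : x < t := by
        by_contra! h'
        exact ht.2 ⟨ht.1.1, h'⟩
      simp only [K]
      rw [indicator_of_notMem (fun h' => by linarith [h'.1]), mul_zero]
  have hright : ∀ t ∈ Ioc a b, ∫ x in Ioc a b, H x * (g t * K (x - t)) =
      g t * ∫ x in t..b, (x - t) ^ (-γ) * h x := by
    intro t ht
    simp only [mul_left_comm _ (g t)]
    rw [MeasureTheory.integral_const_mul, integral_of_le ht.2,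
      setIntegral_eq_of_subset_of_forall_sdiff_eq_zero measurableSet_Ioc
        (Ioc_subset_Ioc_left ht.1.le)]
    · congr 1
      refine setIntegral_congr_fun measurableSet_Ioc fun x hx => ?_
      simp only [K]
      rw [indicator_of_mem (by constructor <;> linarith [ht.1, hx.2, hx.1]), mul_comm,
        hhH ⟨ht.1.le.trans hx.1.le, hx.2⟩]
    · intro x hx
      have : x ≤ t := by
        by_contra! h'
        exact hx.2 ⟨h', hx.1.2⟩
      simp only [K]
      rw [indicator_of_notMem (fun h' => by linarith [h'.1]), mul_zero]
  rw [setIntegral_congr_fun measurableSet_Ioc hleft,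
    setIntegral_congr_fun measurableSet_Ioc hright] at hswap
  unfold rlIl rlIr
  simp only [mul_left_comm _ (1 / Real.Gamma (1 - γ))]
  rw [intervalIntegral.integral_const_mul, intervalIntegral.integral_const_mul,
    integral_of_le hab, integral_of_le hab, hswap]

/-- First variation of `∫ F (x, u x)` along `v`. -/
lemma hasDerivAt_integral_along_line {E : Type*} [NormedAddCommGroup E] [NormedSpace ℝ E]
    {a b : ℝ} (hab : a < b) {F : ℝ × E → ℝ}
    (hF : ContDiffOn ℝ 1 F (Icc a b ×ˢ univ)) {u v : ℝ → E}
    (hu : ContinuousOn u (Icc a b)) (hv : ContinuousOn v (Icc a b)) :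
    HasDerivAt (fun ε : ℝ => ∫ x in a..b, F (x, u x + ε • v x))
      (∫ x in a..b, fderivWithin ℝ F (Icc a b ×ˢ univ) (x, u x) (0, v x)) 0 := by
  have hDc := hF.continuousOn_fderivWithin ((uniqueDiffOn_Icc hab).prod uniqueDiffOn_univ) le_rfl
  have hfst : MapsTo (Prod.fst : ℝ × ℝ → ℝ) (Icc a b ×ˢ univ) (Icc a b) := fun p hp => hp.1
  have hpath : ContinuousOn (fun p : ℝ × ℝ => (p.1, u p.1 + p.2 • v p.1)) (Icc a b ×ˢ univ) := by
    exact continuousOn_fst.prodMk ((hu.comp continuousOn_fst hfst).add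
      (continuousOn_snd.smul (hv.comp continuousOn_fst hfst)))
  have hmaps : MapsTo (fun p : ℝ × ℝ => (p.1, u p.1 + p.2 • v p.1)) (Icc a b ×ˢ univ)
      (Icc a b ×ˢ univ) := fun p hp => ⟨hp.1, mem_univ _⟩
  have hFc : ContinuousOn (fun p : ℝ × ℝ => F (p.1, u p.1 + p.2 • v p.1)) (Icc a b ×ˢ univ) :=
    hF.continuousOn.comp hpath hmaps
  have hD'c : ContinuousOn (fun p : ℝ × ℝ =>
      fderivWithin ℝ F (Icc a b ×ˢ univ) (p.1, u p.1 + p.2 • v p.1) (0, v p.1))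
      (Icc a b ×ˢ univ) :=
    (hDc.comp hpath hmaps).clm_apply
      (continuousOn_const.prodMk (hv.comp continuousOn_fst hfst))
  obtain ⟨M, hM⟩ := (isCompact_Icc.prod (isCompact_Icc (a := (-1 : ℝ)) (b := 1))
    ).exists_bound_of_continuousOn (hD'c.mono (prod_mono_right (subset_univ _)))
  have hslice : ∀ ε : ℝ, ContinuousOn (fun x : ℝ => (x, ε)) (Icc a b) := fun ε => by fun_prop
  have hIoc : uIoc a b ⊆ Icc a b := by
    rw [uIoc_of_le hab.le]
    exact Ioc_subset_Icc_self
  have hFε : ∀ ε : ℝ, ContinuousOn (fun x => F (x, u x + ε • v x)) (Icc a b) := fun ε =>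
    hFc.comp (hslice ε) fun x hx => mk_mem_prod hx (mem_univ ε)
  have key := hasDerivAt_integral_of_dominated_loc_of_deriv_le (μ := volume) (a := a) (b := b)
    (F := fun ε x => F (x, u x + ε • v x))
    (F' := fun ε x => fderivWithin ℝ F (Icc a b ×ˢ univ) (x, u x + ε • v x) (0, v x))
    (x₀ := (0 : ℝ)) (s := Icc (-1) 1) (bound := fun _ => M)
    (Icc_mem_nhds (by norm_num) (by norm_num))
    (Filter.Eventually.of_forall fun ε =>
      ((hFε ε).mono hIoc).aestronglyMeasurable measurableSet_uIoc)
    ((hFε 0).intervalIntegrable_of_Icc hab.le)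
    (((hD'c.comp (hslice 0) fun x hx => mk_mem_prod hx (mem_univ 0)).mono hIoc).aestronglyMeasurable
      measurableSet_uIoc)
    (ae_of_all _ fun x hx ε hε => hM (x, ε) ⟨hIoc hx, hε⟩)
    intervalIntegrable_const
    (ae_of_all _ fun x hx ε _ => by
      have hF' := ((hF.differentiableOn one_ne_zero) (x, u x + ε • v x)
        ⟨hIoc hx, mem_univ _⟩).hasFDerivWithinAt
      have hline : HasDerivAt (fun ε : ℝ => (x, u x + ε • v x)) ((0 : ℝ), v x) ε := by
        refine (hasDerivAt_const ε x).prodMk ?_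
        simpa using ((hasDerivAt_id ε).smul_const (v x)).const_add (u x)
      exact hasDerivWithinAt_univ.mp (hF'.comp_hasDerivWithinAt ε hline.hasDerivWithinAt
        fun ε _ => mk_mem_prod (hIoc hx) (mem_univ (u x + ε • v x))))
  simpa using key.2

lemma deriv_slice_eq_fderivWithin {E : Type*} [NormedAddCommGroup E] [NormedSpace ℝ E]
    {a b : ℝ} {F : ℝ × E → ℝ} (hF : ContDiffOn ℝ 1 F (Icc a b ×ˢ univ)) {x : ℝ}
    (hx : x ∈ Icc a b) {c : ℝ → E} {c' : E} {s : ℝ} (hc : HasDerivAt c c' s) :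
    deriv (fun r => F (x, c r)) s = fderivWithin ℝ F (Icc a b ×ˢ univ) (x, c s) (0, c') := by
  have hF' := ((hF.differentiableOn one_ne_zero) (x, c s) ⟨hx, mem_univ _⟩).hasFDerivWithinAt
  exact (hasDerivWithinAt_univ.mp (hF'.comp_hasDerivWithinAt s
    ((hasDerivAt_const s x).prodMk hc).hasDerivWithinAt
    fun r _ => mk_mem_prod hx (mem_univ (c r)))).deriv

/-- Integration by parts for a test function vanishing at the endpoints. -/
lemma integral_deriv_mul_of_vanishing {a b : ℝ} (hab : a ≤ b) {η I : ℝ → ℝ}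
    (hη : ContDiff ℝ 1 η) (hηa : η a = 0) (hηb : η b = 0)
    (hI : ∀ x ∈ Icc a b, DifferentiableAt ℝ I x) (hI' : ContinuousOn (deriv I) (Icc a b)) :
    ∫ x in a..b, deriv η x * I x = -∫ x in a..b, η x * deriv I x := by
  have h := integral_mul_deriv_eq_deriv_mul (a := a) (b := b) (u := η) (v := I)
    (u' := deriv η) (v' := deriv I)
    (fun x _ => (hη.differentiable one_ne_zero x).hasDerivAt)
    (fun x hx => (hI x (by rwa [uIcc_of_le hab] at hx)).hasDerivAt)
    ((hη.continuous_deriv le_rfl).intervalIntegrable a b)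
    (hI'.intervalIntegrable_of_Icc hab)
  rw [h, hηa, hηb]
  ring

/-- The fundamental lemma of the calculus of variations on `[a,b]`. -/
lemma eqOn_zero_of_integral_mul_eq_zero {a b : ℝ} (hab : a < b) {f : ℝ → ℝ}
    (hf : ContinuousOn f (Icc a b))
    (h : ∀ η : ℝ → ℝ, ContDiff ℝ 1 η → η a = 0 → η b = 0 → ∫ x in a..b, η x * f x = 0) :
    EqOn f 0 (Icc a b) := by
  have hae := isOpen_Ioo.ae_eq_zero_of_integral_contDiff_smul_eq_zero (μ := volume)
    (f := f) (U := Ioo a b)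
    ((hf.mono Ioo_subset_Icc_self).locallyIntegrableOn measurableSet_Ioo)
    (fun η hη _ hsupp => by
      have hz : ∀ x, x ∉ Ioo a b → η x = 0 := fun x hx =>
        image_eq_zero_of_notMem_tsupport fun hx' => hx (hsupp hx')
      have := h η (hη.of_le (by exact_mod_cast le_top)) (hz a (by simp)) (hz b (by simp))
      rw [integral_of_le hab.le] at this
      rw [← this]
      refine (setIntegral_eq_integral_of_forall_compl_eq_zero fun x hx => ?_).symm
      rw [hz x fun hx' => hx (Ioo_subset_Ioc_self hx'), zero_smul])
  refine Measure.eqOn_Icc_of_ae_eq volume hab.ne ?_ hf continuousOn_const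
  rw [← restrict_Ioo_eq_restrict_Icc, Filter.EventuallyEq, ae_restrict_iff' measurableSet_Ioo]
  exact hae

/-- Fractional Euler–Lagrange equation: if `y` is a minimizer or maximizer of `J` on `E`,
then `∂₂L + ₓD_b^α[∂₃L] + ₐDₓ^β[∂₄L] = 0` along `(ᶜ_α[y]_β)` on `[a,b]`. -/
theorem fractional_euler_lagrange (a b α β ya yb : ℝ) (ha : a < b)
    (hα : α ∈ Set.Ioo (0 : ℝ) 1) (hβ : β ∈ Set.Ioo (0 : ℝ) 1)
    (L : ℝ → ℝ → ℝ → ℝ → ℝ)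
    (hL : ContDiffOn ℝ 1 (fun p : ℝ × ℝ × ℝ × ℝ => L p.1 p.2.1 p.2.2.1 p.2.2.2)
      (Set.Icc a b ×ˢ (Set.univ : Set (ℝ × ℝ × ℝ))))
    -- for every `y ∈ E`, `∂₃L ∘ ᶜ_α[y]_β` has a continuous right Riemann–Liouville
    -- derivative of order `α`, and `∂₄L ∘ ᶜ_α[y]_β` a continuous left one of order `β`:
    (hD3 : ∀ y, inE a b ya yb y →
      (∀ x ∈ Set.Icc a b, DifferentiableAt ℝ (rlIr b α (P3 a b α β L y)) x) ∧
        ContinuousOn (rlDr b α (P3 a b α β L y)) (Set.Icc a b))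
    (hD4 : ∀ y, inE a b ya yb y →
      (∀ x ∈ Set.Icc a b, DifferentiableAt ℝ (rlIl a β (P4 a b α β L y)) x) ∧
        ContinuousOn (rlDl a β (P4 a b α β L y)) (Set.Icc a b))
    (y : ℝ → ℝ) (hy : inE a b ya yb y)
    (hopt : (∀ z, inE a b ya yb z → Jfun a b α β L y ≤ Jfun a b α β L z) ∨
            (∀ z, inE a b ya yb z → Jfun a b α β L z ≤ Jfun a b α β L y)) :
    ∀ x ∈ Set.Icc a b,
      P2 a b α β L y x + rlDr b α (P3 a b α β L y) x + rlDl a β (P4 a b α β L y) x = 0 := by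
  obtain ⟨hyC, hya, hyb⟩ := hy
  obtain ⟨hI3, hI3c⟩ := hD3 y ⟨hyC, hya, hyb⟩
  obtain ⟨hI4, hI4c⟩ := hD4 y ⟨hyC, hya, hyb⟩
  have hγα : α ≠ 0 := hα.1.ne'
  have hγβ : β ≠ 0 := hβ.1.ne'
  have hUD := uniqueDiffOn_Icc ha
  have hdy : ContinuousOn (derivWithin y (Icc a b)) (Icc a b) :=
    hyC.continuousOn_derivWithin hUD le_rfl
  set F : ℝ × ℝ × ℝ × ℝ → ℝ := fun p => L p.1 p.2.1 p.2.2.1 p.2.2.2 with hFdef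
  set u : ℝ → ℝ × ℝ × ℝ := fun x => (y x, capL a b α y x, capR a b β y x) with hudef
  have hu : ContinuousOn u (Icc a b) := hyC.continuousOn.prodMk
    ((continuousOn_rlIl ha.le hα.2 hdy).prodMk (continuousOn_rlIr ha.le hβ.2 hdy).neg)
  set D : ℝ → ℝ × ℝ × ℝ × ℝ →L[ℝ] ℝ :=
    fun x => fderivWithin ℝ F (Icc a b ×ˢ univ) (x, u x) with hDdef
  have hDc : ContinuousOn D (Icc a b) :=
    (hL.continuousOn_fderivWithin (hUD.prod uniqueDiffOn_univ) le_rfl).comp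
      (continuousOn_id.prodMk hu) fun x hx => mk_mem_prod hx (mem_univ (u x))
  have hP2 : ∀ x ∈ Icc a b, P2 a b α β L y x = D x (0, 1, 0, 0) := fun x hx =>
    deriv_slice_eq_fderivWithin hL hx
      (c := fun r => (r, capL a b α y x, capR a b β y x)) (c' := (1, 0, 0))
      ((hasDerivAt_id _).prodMk ((hasDerivAt_const _ _).prodMk (hasDerivAt_const _ _)))
  have hP3 : ∀ x ∈ Icc a b, P3 a b α β L y x = D x (0, 0, 1, 0) := fun x hx =>
    deriv_slice_eq_fderivWithin hL hx
      (c := fun r => (y x, r, capR a b β y x)) (c' := (0, 1, 0))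
      ((hasDerivAt_const _ _).prodMk ((hasDerivAt_id _).prodMk (hasDerivAt_const _ _)))
  have hP4 : ∀ x ∈ Icc a b, P4 a b α β L y x = D x (0, 0, 0, 1) := fun x hx =>
    deriv_slice_eq_fderivWithin hL hx
      (c := fun r => (y x, capL a b α y x, r)) (c' := (0, 0, 1))
      ((hasDerivAt_const _ _).prodMk ((hasDerivAt_const _ _).prodMk (hasDerivAt_id _)))
  have hP2c : ContinuousOn (P2 a b α β L y) (Icc a b) :=
    (hDc.clm_apply continuousOn_const).congr hP2
  have hP3c : ContinuousOn (P3 a b α β L y) (Icc a b) :=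
    (hDc.clm_apply continuousOn_const).congr hP3
  have hP4c : ContinuousOn (P4 a b α β L y) (Icc a b) :=
    (hDc.clm_apply continuousOn_const).congr hP4
  refine eqOn_zero_of_integral_mul_eq_zero ha ((hP2c.add hI3c).add hI4c) fun η hη hηa hηb => ?_
  have hdηc : ContinuousOn (deriv η) (Icc a b) := (hη.continuous_deriv le_rfl).continuousOn
  set v : ℝ → ℝ × ℝ × ℝ :=
    fun x => (η x, rlIl a α (deriv η) x, -rlIr b β (deriv η) x) with hvdef
  have hlc := continuousOn_rlIl ha.le hα.2 hdηc
  have hrc := continuousOn_rlIr ha.le hβ.2 hdηc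
  have hv : ContinuousOn v (Icc a b) := hη.continuous.continuousOn.prodMk (hlc.prodMk hrc.neg)
  have hE : ∀ ε : ℝ, inE a b ya yb (fun x => y x + ε * η x) := fun ε =>
    ⟨hyC.add (contDiff_const.mul hη).contDiffOn, by simp [hηa, hya], by simp [hηb, hyb]⟩
  have hdz : ∀ ε : ℝ, EqOn (derivWithin (fun x => y x + ε * η x) (Icc a b))
      (fun x => derivWithin y (Icc a b) x + ε * deriv η x) (Icc a b) := fun ε x hx =>
    (((hyC.differentiableOn one_ne_zero x hx).hasDerivWithinAt).add
      ((hη.differentiable one_ne_zero x).hasDerivAt.const_mul ε).hasDerivWithinAt).derivWithin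
      (hUD x hx)
  have hJ : ∀ ε : ℝ, Jfun a b α β L (fun x => y x + ε * η x) =
      ∫ x in a..b, F (x, u x + ε • v x) := fun ε => by
    refine integral_congr fun x hx => ?_
    rw [uIcc_of_le ha.le] at hx
    have hl : capL a b α (fun x => y x + ε * η x) x =
        capL a b α y x + ε * rlIl a α (deriv η) x :=
      (rlIl_congr (hdz ε) hx).trans (rlIl_add_const_mul hα.2 hdy hdηc hx ε)
    have hr : capR a b β (fun x => y x + ε * η x) x =
        capR a b β y x + ε * -rlIr b β (deriv η) x := by
      have h := (rlIr_congr (γ := β) (hdz ε) hx).trans (rlIr_add_const_mul hβ.2 hdy hdηc hx ε)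
      change -rlIr b β _ x = -rlIr b β _ x + _
      rw [h]
      ring
    simp only [hl, hr, hFdef, hudef, hvdef, Prod.fst_add, Prod.snd_add, Prod.smul_fst,
      Prod.smul_snd, smul_eq_mul]
  have hderiv := hasDerivAt_integral_along_line ha hL hu hv
  rw [← funext hJ] at hderiv
  have hextr : IsLocalExtr (fun ε : ℝ => Jfun a b α β L fun x => y x + ε * η x) 0 := by
    rcases hopt with h | h
    · exact Or.inl (Filter.Eventually.of_forall fun ε => by simpa using h _ (hE ε))
    · exact Or.inr (Filter.Eventually.of_forall fun ε => by simpa using h _ (hE ε))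
  have hzero := hextr.hasDerivAt_eq_zero hderiv
  have hexp : ∫ x in a..b, fderivWithin ℝ F (Icc a b ×ˢ univ) (x, u x) (0, v x) =
      ∫ x in a..b, (η x * P2 a b α β L y x + P3 a b α β L y x * rlIl a α (deriv η) x
        - P4 a b α β L y x * rlIr b β (deriv η) x) := by
    refine integral_congr fun x hx => ?_
    rw [uIcc_of_le ha.le] at hx
    have hdecomp : ((0 : ℝ), v x) = η x • ((0, 1, 0, 0) : ℝ × ℝ × ℝ × ℝ)
        + rlIl a α (deriv η) x • ((0, 0, 1, 0) : ℝ × ℝ × ℝ × ℝ)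
        - rlIr b β (deriv η) x • ((0, 0, 0, 1) : ℝ × ℝ × ℝ × ℝ) := by
      simp [hvdef]
    change D x (0, v x) = _
    rw [hdecomp, map_sub, map_add, map_smul, map_smul, map_smul, ← hP2 x hx, ← hP3 x hx,
      ← hP4 x hx]
    simp only [smul_eq_mul]
    ring
  have hηc : ContinuousOn η (Icc a b) := hη.continuous.continuousOn
  have hmul : ∀ {f g : ℝ → ℝ}, ContinuousOn f (Icc a b) → ContinuousOn g (Icc a b) →
      IntervalIntegrable (fun x => f x * g x) volume a b :=
    fun hf hg => (hf.mul hg).intervalIntegrable_of_Icc ha.le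
  have hI3c' : ContinuousOn (deriv (rlIr b α (P3 a b α β L y))) (Icc a b) :=
    hI3c.neg.congr fun x _ => (neg_neg _).symm
  have hparts3 : ∫ x in a..b, P3 a b α β L y x * rlIl a α (deriv η) x =
      ∫ x in a..b, η x * rlDr b α (P3 a b α β L y) x := by
    rw [integral_mul_rlIl ha.le hγα hα.2 hdηc hP3c,
      integral_deriv_mul_of_vanishing ha.le hη hηa hηb hI3 hI3c',
      ← intervalIntegral.integral_neg]
    simp only [rlDr, mul_neg]
  have hparts4 : ∫ x in a..b, P4 a b α β L y x * rlIr b β (deriv η) x =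
      -∫ x in a..b, η x * rlDl a β (P4 a b α β L y) x := by
    rw [← integral_mul_rlIl ha.le hγβ hβ.2 hP4c hdηc]
    exact integral_deriv_mul_of_vanishing ha.le hη hηa hηb hI4 hI4c
  rw [hexp, intervalIntegral.integral_sub ((hmul hηc hP2c).add (hmul hP3c hlc)) (hmul hP4c hrc),
    intervalIntegral.integral_add (hmul hηc hP2c) (hmul hP3c hlc), hparts3, hparts4,
    sub_neg_eq_add] at hzero
  simp only [mul_add]
  rw [intervalIntegral.integral_add ((hmul hηc hP2c).add (hmul hηc hI3c)) (hmul hηc hI4c),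
    intervalIntegral.integral_add (hmul hηc hP2c) (hmul hηc hI3c), hzero]
end

section
/- Let 0 < α < 1 and let ȳ : [0,1] → ℝ be defined by ȳ(x) = E_α(x^α), where E_α is the Mittag–Leffler function. Then with λ = −2, the function y = ȳ satisfies the fractional Euler–Lagrange equation of the isoperimetric problem with Lagrangians L(x,y,v) = v² and g(x,y,v) = ȳ(x)·v on [0,1]: namely, {}_x D_1^α[ t ↦ 2·({}_0^C D_t^α ȳ)(t) + λ·ȳ(t) ](x) = 0 for all x ∈ (0,1). -/
open Set MeasureTheory intervalIntegral

/-- The Mittag–Leffler function `E_α(z) = Σ_{k=0}^∞ z^k / Γ(αk + 1)`. -/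
noncomputable def mittagLeffler (α z : ℝ) : ℝ :=
  ∑' k : ℕ, z ^ k / Real.Gamma (α * k + 1)

/-- `ȳ(x) = E_α(x^α)`. -/
noncomputable def ybar (α x : ℝ) : ℝ := mittagLeffler α (x ^ α)

/-- Left Caputo fractional derivative of order `α ∈ (0,1)` based at `0`:
`(₀ᶜDₓ^α f)(x) = (1/Γ(1-α)) ∫_0^x (x-t)^(-α) f'(t) dt`. -/
noncomputable def caputo0 (α : ℝ) (f : ℝ → ℝ) : ℝ → ℝ := fun x =>
  (1 / Real.Gamma (1 - α)) * ∫ t in (0 : ℝ)..x, (x - t) ^ (-α) * deriv f t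

/-- Right Riemann–Liouville fractional derivative of order `α ∈ (0,1)` on `[·,1]`:
`(ₓD_1^α h)(x) = -(d/dx)[(1/Γ(1-α)) ∫_x^1 (t-x)^(-α) h(t) dt]`. -/
noncomputable def rlDr1 (α : ℝ) (h : ℝ → ℝ) : ℝ → ℝ := fun x =>
  -deriv (fun u => (1 / Real.Gamma (1 - α)) *
    ∫ t in u..(1 : ℝ), (t - u) ^ (-α) * h t) x

/-- The elementary lower bound `R ^ s * e ^ (-R) ≤ Γ(s + 1)`. -/
theorem rpow_mul_exp_neg_le_Gamma_add_one {R s : ℝ} (hR : 0 < R) (hs : 0 ≤ s) :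
    R ^ s * Real.exp (-R) ≤ Real.Gamma (s + 1) := by
  have hint : IntegrableOn (fun t : ℝ => Real.exp (-t) * t ^ (s + 1 - 1)) (Ioi 0) :=
    Real.GammaIntegral_convergent (by linarith)
  have hsub : Ioi R ⊆ Ioi 0 := Ioi_subset_Ioi hR.le
  calc R ^ s * Real.exp (-R) = ∫ t in Ioi R, R ^ s * Real.exp (-t) := by
        rw [MeasureTheory.integral_const_mul, integral_exp_neg_Ioi]
    _ ≤ ∫ t in Ioi R, Real.exp (-t) * t ^ (s + 1 - 1) := by
        refine setIntegral_mono_on ((integrableOn_exp_neg_Ioi R).const_mul _)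
          (hint.mono_set hsub) measurableSet_Ioi fun t ht => ?_
        rw [mul_comm, add_sub_cancel_right]
        exact mul_le_mul_of_nonneg_left (Real.rpow_le_rpow hR.le (le_of_lt ht) hs)
          (Real.exp_pos _).le
    _ ≤ ∫ t in Ioi 0, Real.exp (-t) * t ^ (s + 1 - 1) := by
        refine setIntegral_mono_set hint ?_ (Filter.Eventually.of_forall hsub)
        filter_upwards [ae_restrict_mem measurableSet_Ioi] with t ht
        exact mul_nonneg (Real.exp_pos _).le (Real.rpow_nonneg (le_of_lt ht) _)
    _ = Real.Gamma (s + 1) := (Real.Gamma_eq_integral (by linarith)).symm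

theorem Gamma_mul_natCast_add_one_pos {α : ℝ} (hα : 0 < α) (k : ℕ) :
    0 < Real.Gamma (α * k + 1) :=
  Real.Gamma_pos_of_pos (by positivity)

/-- The Mittag–Leffler coefficients decay faster than any geometric sequence. -/
theorem exists_inv_Gamma_le_mul_pow {α : ℝ} (hα : 0 < α) {ρ : ℝ} (hρ : 0 < ρ) :
    ∃ C : ℝ, 0 ≤ C ∧ ∀ k : ℕ, (Real.Gamma (α * k + 1))⁻¹ ≤ C * ρ ^ k := by
  set R : ℝ := ρ⁻¹ ^ α⁻¹ with hR
  have hR0 : 0 < R := by positivity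
  refine ⟨Real.exp R, (Real.exp_pos _).le, fun k => ?_⟩
  have h := rpow_mul_exp_neg_le_Gamma_add_one hR0 (s := α * k) (by positivity)
  have hRk : R ^ (α * k) = (ρ ^ k)⁻¹ := by
    rw [Real.rpow_mul hR0.le, hR, Real.rpow_inv_rpow (by positivity) hα.ne', Real.rpow_natCast,
      inv_pow]
  rw [hRk, Real.exp_neg, ← mul_inv] at h
  calc (Real.Gamma (α * k + 1))⁻¹ ≤ ((ρ ^ k * Real.exp R)⁻¹)⁻¹ :=
        inv_anti₀ (by positivity) h
    _ = Real.exp R * ρ ^ k := by rw [inv_inv, mul_comm]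

theorem summable_natCast_mul_pow_div_Gamma {α : ℝ} (hα : 0 < α) {R : ℝ} (hR : 0 < R) :
    Summable fun k : ℕ => (k : ℝ) * R ^ (k - 1) / Real.Gamma (α * k + 1) := by
  obtain ⟨C, hC, h⟩ := exists_inv_Gamma_le_mul_pow hα (ρ := (2 * R)⁻¹) (by positivity)
  have hgeom : Summable fun k : ℕ => (k : ℝ) ^ 1 * (1 / 2 : ℝ) ^ k :=
    summable_pow_mul_geometric_of_norm_lt_one 1 (by norm_num)
  refine Summable.of_nonneg_of_le (fun k => ?_) (fun k => ?_) (hgeom.mul_left (C * R⁻¹))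
  · have := Gamma_mul_natCast_add_one_pos hα k
    positivity
  · rw [div_eq_mul_inv]
    refine (mul_le_mul_of_nonneg_left (h k) (by positivity)).trans_eq ?_
    rcases k with _ | k
    · simp
    · simp only [Nat.add_sub_cancel, mul_inv, mul_pow, pow_one, one_div, inv_pow]
      field_simp
      ring

theorem summable_pow_div_Gamma {α : ℝ} (hα : 0 < α) {z : ℝ} (hz : 0 ≤ z) :
    Summable fun k : ℕ => z ^ k / Real.Gamma (α * k + 1) := by
  obtain ⟨C, hC, h⟩ := exists_inv_Gamma_le_mul_pow hα (ρ := (2 * (z + 1))⁻¹) (by positivity)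
  refine Summable.of_nonneg_of_le (fun k => ?_) (fun k => ?_)
    ((summable_geometric_of_lt_one (r := 1 / 2) (by norm_num) (by norm_num)).mul_left C)
  · have := Gamma_mul_natCast_add_one_pos hα k
    positivity
  · rw [div_eq_mul_inv]
    refine (mul_le_mul_of_nonneg_left (h k) (by positivity)).trans ?_
    rw [mul_left_comm, ← mul_pow]
    refine mul_le_mul_of_nonneg_left (pow_le_pow_left₀ (by positivity) ?_ k) hC
    rw [← div_eq_mul_inv, div_le_div_iff₀ (by positivity) (by norm_num)]
    linarith

theorem hasDerivAt_mittagLeffler {α : ℝ} (hα : 0 < α) (z : ℝ) :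
    HasDerivAt (mittagLeffler α) (∑' k : ℕ, (k : ℝ) * z ^ (k - 1) / Real.Gamma (α * k + 1)) z := by
  have hR : 0 < |z| + 1 := by positivity
  change HasDerivAt (fun w => ∑' k : ℕ, w ^ k / Real.Gamma (α * k + 1)) _ z
  refine hasDerivAt_tsum_of_isPreconnected (t := Metric.ball 0 (|z| + 1)) (y₀ := 0)
    (g := fun (k : ℕ) w => w ^ k / Real.Gamma (α * k + 1))
    (g' := fun (k : ℕ) w => (k : ℝ) * w ^ (k - 1) / Real.Gamma (α * k + 1))
    (summable_natCast_mul_pow_div_Gamma hα hR) Metric.isOpen_ball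
    (convex_ball _ _).isPreconnected (fun k y _ => (hasDerivAt_pow k y).div_const _)
    (fun k y hy => ?_) (by simpa using hR) (summable_pow_div_Gamma hα le_rfl) (by simp)
  have := Gamma_mul_natCast_add_one_pos hα k
  rw [mem_ball_zero_iff] at hy
  rw [norm_div, norm_mul, norm_pow, Real.norm_natCast, Real.norm_of_nonneg this.le]
  gcongr

theorem deriv_ybar {α : ℝ} (hα : 0 < α) {t : ℝ} (ht : 0 < t) :
    deriv (ybar α) t =
      ∑' k : ℕ, t ^ (α * (k + 1) - 1) / Real.Gamma (α * (k + 1)) := by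
  have h : HasDerivAt (ybar α) _ t :=
    (hasDerivAt_mittagLeffler hα (t ^ α)).comp t
      (Real.hasDerivAt_rpow_const (p := α) (Or.inl ht.ne'))
  rw [h.deriv, (summable_natCast_mul_pow_div_Gamma hα (Real.rpow_pos_of_pos ht α)).tsum_eq_zero_add,
    Nat.cast_zero, zero_mul, zero_div, zero_add, ← tsum_mul_right]
  refine tsum_congr fun k => ?_
  have hs : 0 < α * ((k : ℝ) + 1) := by positivity
  have := Real.Gamma_pos_of_pos hs
  have hpow : t ^ (α * ((k : ℝ) + 1) - 1) = (t ^ α) ^ k * t ^ (α - 1) := by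
    rw [← Real.rpow_mul_natCast ht.le, ← Real.rpow_add ht]
    ring_nf
  rw [Nat.add_sub_cancel, Nat.cast_add_one, Real.Gamma_add_one hs.ne', hpow]
  field_simp

/-- The Beta integral on `[0, x]`, in the form needed for the Caputo derivative of a power. -/
theorem integral_sub_rpow_mul_rpow {s t x : ℝ} (hs : 0 < s) (ht : 0 < t) (hx : 0 < x) :
    ∫ u in (0 : ℝ)..x, (x - u) ^ (t - 1) * u ^ (s - 1) =
      x ^ (s + t - 1) * (Real.Gamma s * Real.Gamma t / Real.Gamma (s + t)) := by
  have h := Complex.betaIntegral_scaled (s : ℂ) (t : ℂ) hx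
  rw [Complex.betaIntegral_eq_Gamma_mul_div _ _ (by simpa) (by simpa)] at h
  rw [← Complex.ofReal_inj, ← intervalIntegral.integral_ofReal]
  have hx' : ((x ^ (s + t - 1) : ℝ) : ℂ) = (x : ℂ) ^ ((s : ℂ) + t - 1) := by
    rw [Complex.ofReal_cpow hx.le]; push_cast; rfl
  rw [Complex.ofReal_mul, hx', Complex.ofReal_div, Complex.ofReal_mul, ← Complex.Gamma_ofReal,
    ← Complex.Gamma_ofReal, ← Complex.Gamma_ofReal, Complex.ofReal_add, ← h]
  refine intervalIntegral.integral_congr fun u hu => ?_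
  rw [uIcc_of_le hx.le] at hu
  rw [Complex.ofReal_mul, Complex.ofReal_cpow (sub_nonneg.2 hu.2), Complex.ofReal_cpow hu.1]
  push_cast
  ring

theorem intervalIntegrable_sub_rpow_mul_rpow {s t x : ℝ} (hs : 0 < s) (ht : 0 < t) (hx : 0 < x) :
    IntervalIntegrable (fun u : ℝ => (x - u) ^ (t - 1) * u ^ (s - 1)) volume 0 x := by
  refine intervalIntegrable_of_integral_ne_zero ?_
  rw [integral_sub_rpow_mul_rpow hs ht hx]
  have := Real.Gamma_pos_of_pos hs
  have := Real.Gamma_pos_of_pos ht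
  have := Real.Gamma_pos_of_pos (add_pos hs ht)
  positivity

/-- `ȳ` is an eigenfunction, with eigenvalue `1`, of the left Caputo derivative. -/
theorem caputo0_ybar {α : ℝ} (hα₀ : 0 < α) (hα₁ : α < 1) {x : ℝ} (hx : 0 < x) :
    caputo0 α (ybar α) x = ybar α x := by
  have hΓ : 0 < Real.Gamma (1 - α) := Real.Gamma_pos_of_pos (by linarith)
  have hpos (k : ℕ) : 0 < α * (k + 1) := by positivity
  set F : ℕ → ℝ → ℝ := fun k u =>
    (x - u) ^ (1 - α - 1) * u ^ (α * (k + 1) - 1) / Real.Gamma (α * (k + 1)) with hF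
  have hFint (k : ℕ) : IntegrableOn (F k) (Ioc 0 x) := by
    have := intervalIntegrable_sub_rpow_mul_rpow (hpos k) (sub_pos.2 hα₁) hx
    exact (((intervalIntegrable_iff_integrableOn_Ioc_of_le hx.le).1 this)).div_const _
  have hFval (k : ℕ) : ∫ u in Ioc 0 x, F k u =
      Real.Gamma (1 - α) * ((x ^ α) ^ k / Real.Gamma (α * k + 1)) := by
    rw [← intervalIntegral.integral_of_le hx.le, intervalIntegral.integral_div,
      integral_sub_rpow_mul_rpow (hpos k) (sub_pos.2 hα₁) hx, ← Real.rpow_mul_natCast hx.le,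
      show α * ((k : ℝ) + 1) + (1 - α) = α * k + 1 by ring, add_sub_cancel_right]
    have := (Real.Gamma_pos_of_pos (hpos k)).ne'
    field_simp
  have hFnorm (k : ℕ) : ∫ u in Ioc 0 x, ‖F k u‖ = ∫ u in Ioc 0 x, F k u := by
    refine setIntegral_congr_fun measurableSet_Ioc fun u hu => Real.norm_of_nonneg ?_
    exact div_nonneg (mul_nonneg (Real.rpow_nonneg (sub_nonneg.2 hu.2) _)
      (Real.rpow_nonneg hu.1.le _)) (Real.Gamma_pos_of_pos (hpos k)).le
  have hsum := hasSum_integral_of_summable_integral_norm hFint (by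
    simp_rw [hFnorm, hFval]
    exact (summable_pow_div_Gamma hα₀ (Real.rpow_nonneg hx.le α)).mul_left _)
  have hintegrand : ∫ u in (0 : ℝ)..x, (x - u) ^ (-α) * deriv (ybar α) u =
      ∫ u in Ioc 0 x, ∑' k, F k u := by
    rw [intervalIntegral.integral_of_le hx.le]
    refine setIntegral_congr_fun measurableSet_Ioc fun u hu => ?_
    simp only [hF, deriv_ybar hα₀ hu.1, ← tsum_mul_left, mul_div_assoc]
    rw [show 1 - α - 1 = -α by ring]
  simp_rw [hFval] at hsum
  rw [caputo0, hintegrand, ← hsum.tsum_eq, tsum_mul_left, ← mul_assoc, one_div,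
    inv_mul_cancel₀ hΓ.ne', one_mul, ybar, mittagLeffler]

/-- With `λ = −2`, the function `y = ȳ`, `ȳ(x) = E_α(x^α)`, satisfies the fractional
Euler–Lagrange equation of the isoperimetric problem with `L(x,y,v) = v²` and
`g(x,y,v) = ȳ(x)·v` on `[0,1]`:
`ₓD_1^α[t ↦ 2·(₀ᶜD_t^α ȳ)(t) + λ·ȳ(t)](x) = 0` for all `x ∈ (0,1)`. -/
theorem mittagLeffler_solves_isoperimetric_EL_equation (α : ℝ)
    (hα₀ : 0 < α) (hα₁ : α < 1) (lam : ℝ) (hlam : lam = -2) :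
    ∀ x ∈ Set.Ioo (0 : ℝ) 1,
      rlDr1 α (fun t => 2 * caputo0 α (ybar α) t + lam * ybar α t) x = 0 := by
  intro x hx
  rw [rlDr1, neg_eq_zero]
  have hzero : (fun u => (1 / Real.Gamma (1 - α)) * ∫ t in u..(1 : ℝ), (t - u) ^ (-α) *
      (2 * caputo0 α (ybar α) t + lam * ybar α t)) =ᶠ[nhds x] fun _ => 0 := by
    filter_upwards [Ioo_mem_nhds hx.1 hx.2] with u hu
    rw [intervalIntegral.integral_of_le hu.2.le, setIntegral_eq_zero_of_forall_eq_zero, mul_zero]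
    intro t ht
    rw [caputo0_ybar hα₀ hα₁ (hu.1.trans ht.1), hlam]
    ring
  rw [hzero.deriv_eq, deriv_const]
end
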